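/- Let e_1,…,e_m be variables of R with deg(e_i) = ē_i ∈ P. Let Q^1,…,Q^m and J^1,…,J^m be P-homogeneous ideals with Q^i ⊆ J^i for each i, and let s : P → ℕ be a function. Assume: (1) dim_k (J^i)_D = s(D) for all i and all D ∈ P; (2) for each i, e_i is a nonzerodivisor on R/Q^i; (3) all the Q^i have a common Hilbert function, i.e. dim_k (Q^i)_D = dim_k (Q^j)_D for all i, j and all D ∈ P; (4) for every D ∈ P there exist an index j and natural numbers a_1,…,a_m with dim_k (Q^j)_{D + a_1ē_1 + … + a_mē_m} = s(D + a_1ē_1 + … + a_mē_m). Then Q^i = J^i for all i. -/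

import Mathlib

open MvPolynomial

/-- The image of a monomial (exponent vector) under a permutation `g` of the variables. -/
noncomputable def actMon {n : ℕ} (g : Equiv.Perm (Fin n)) (a : Fin n →₀ ℕ) : Fin n →₀ ℕ :=
  Finsupp.mapDomain g a

/-- Total degree of an exponent vector. -/
def tdeg {n : ℕ} (a : Fin n →₀ ℕ) : ℕ := a.sum fun _ e => e

/-- `le` is a monomial order. -/
def IsMonOrder {n : ℕ} (le : (Fin n →₀ ℕ) → (Fin n →₀ ℕ) → Prop) : Prop :=
  (∀ a b, le a b ∨ le b a) ∧ (∀ a b, le a b → le b a → a = b) ∧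
    (∀ a b c, le a b → le b c → le a c) ∧ (∀ a, le 0 a) ∧
    (∀ a b c, le a b → le (a + c) (b + c))

/-- The initial ideal of `I` with respect to the monomial order `le`. -/
noncomputable def initIdeal {k : Type*} [Field k] {n : ℕ}
    (le : (Fin n →₀ ℕ) → (Fin n →₀ ℕ) → Prop) (I : Ideal (MvPolynomial (Fin n) k)) :
    Ideal (MvPolynomial (Fin n) k) :=
  Ideal.span { m | ∃ f ∈ I, f ≠ 0 ∧ ∃ a ∈ f.support,
    (∀ b ∈ f.support, le b a) ∧ m = monomial a (1 : k) }

/-- `G` acts monomially on `I` up to degree `d`. -/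
def MonomialActionUpTo {k : Type*} [Field k] {n : ℕ} {G : Type*} [Group G]
    (ρ : G →* Equiv.Perm (Fin n)) (I : Ideal (MvPolynomial (Fin n) k)) (d : ℕ) : Prop :=
  ∀ g : G, ∀ h ∈ I, h.totalDegree ≤ d →
    ∃ h' ∈ I, h'.support = h.support.image (actMon (ρ g))

/-- The `P`-degree of a monomial, for the grading assigning degree `deg i` to `x_i`. -/
def mdeg {n : ℕ} {P : Type*} [AddCommMonoid P] (deg : Fin n → P) (a : Fin n →₀ ℕ) : P :=
  a.sum fun i e => e • deg i

/-- An ideal is `P`-homogeneous if it is generated by `P`-homogeneous elements. -/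
def IsPHomog {k : Type*} [Field k] {n : ℕ} {P : Type*} [AddCommMonoid P]
    (deg : Fin n → P) (I : Ideal (MvPolynomial (Fin n) k)) : Prop :=
  ∃ S : Set (MvPolynomial (Fin n) k), I = Ideal.span S ∧
    ∀ f ∈ S, ∃ D : P, ∀ a ∈ f.support, mdeg deg a = D

/-- The `k`-subspace of `P`-homogeneous polynomials of degree `D`. -/
noncomputable def degSub {k : Type*} [Field k] {n : ℕ} {P : Type*} [AddCommMonoid P]
    (deg : Fin n → P) (D : P) : Submodule k (MvPolynomial (Fin n) k) :=
  Submodule.span k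
    ((fun a => (monomial a (1 : k) : MvPolynomial (Fin n) k)) '' { a | mdeg deg a = D })

/-- The degree-`D` graded piece `Q_D` of a `P`-homogeneous ideal `Q`: the `k`-vector space of
`P`-homogeneous elements of degree `D` lying in `Q`. -/
noncomputable def idealPiece {k : Type*} [Field k] {n : ℕ} {P : Type*} [AddCommMonoid P]
    (Q : Ideal (MvPolynomial (Fin n) k)) (deg : Fin n → P) (D : P) :
    Submodule k (MvPolynomial (Fin n) k) :=
  Submodule.restrictScalars k Q ⊓ degSub deg D

/-- The degree-`D` graded piece `(R/Q)_D` of the quotient: the image in `R/Q` of the span of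
the monomials of degree `D`. -/
noncomputable def quotPiece {k : Type*} [Field k] {n : ℕ} {P : Type*} [AddCommMonoid P]
    (Q : Ideal (MvPolynomial (Fin n) k)) (deg : Fin n → P) (D : P) :
    Submodule k
      (MvPolynomial (Fin n) k ⧸ Submodule.restrictScalars k Q) :=
  Submodule.map (Submodule.restrictScalars k Q).mkQ (degSub deg D)

theorem mdeg_add {n : ℕ} {P : Type*} [AddCommMonoid P] (deg : Fin n → P) (a b : Fin n →₀ ℕ) :
    mdeg deg (a + b) = mdeg deg a + mdeg deg b :=
  Finsupp.sum_add_index' (fun _ => zero_smul _ _) fun _ _ _ => add_smul _ _ _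

theorem mdeg_single {n : ℕ} {P : Type*} [AddCommMonoid P] (deg : Fin n → P) (i : Fin n) :
    mdeg deg (Finsupp.single i 1) = deg i := by
  simp [mdeg]

theorem finite_mdeg_eq {n : ℕ} {P : Type*} [AddCommMonoid P] (deg : Fin n → P)
    (lam : P →+ ℕ) (hlam : ∀ i, lam (deg i) = 1) (D : P) :
    { a : Fin n →₀ ℕ | mdeg deg a = D }.Finite := by
  refine (Set.finite_Iic (Finsupp.equivFunOnFinite.symm fun _ : Fin n => lam D)).subset ?_
  rintro a rfl i
  have h : lam (mdeg deg a) = ∑ j, a j := by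
    rw [mdeg, Finsupp.sum_fintype _ _ (by simp)]
    simp [hlam]
  simpa [h] using Finset.single_le_sum (f := a) (fun _ _ => Nat.zero_le _) (Finset.mem_univ i)

theorem finiteDimensional_degSub {k : Type*} [Field k] {n : ℕ} {P : Type*} [AddCommMonoid P]
    (deg : Fin n → P) (lam : P →+ ℕ) (hlam : ∀ i, lam (deg i) = 1) (D : P) :
    FiniteDimensional k (degSub (k := k) deg D) :=
  FiniteDimensional.span_of_finite k ((finite_mdeg_eq deg lam hlam D).image _)

theorem finiteDimensional_idealPiece {k : Type*} [Field k] {n : ℕ} {P : Type*}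
    [AddCommMonoid P] (deg : Fin n → P) (lam : P →+ ℕ) (hlam : ∀ i, lam (deg i) = 1)
    (Q : Ideal (MvPolynomial (Fin n) k)) (D : P) :
    FiniteDimensional k (idealPiece Q deg D) := by
  have := finiteDimensional_degSub (k := k) deg lam hlam D
  exact Submodule.finiteDimensional_of_le (inf_le_right : idealPiece Q deg D ≤ degSub deg D)

theorem idealPiece_mono {k : Type*} [Field k] {n : ℕ} {P : Type*} [AddCommMonoid P]
    (deg : Fin n → P) {Q J : Ideal (MvPolynomial (Fin n) k)} (h : Q ≤ J) (D : P) :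
    idealPiece Q deg D ≤ idealPiece J deg D :=
  fun _ hf => ⟨h hf.1, hf.2⟩

theorem mem_degSub {k : Type*} [Field k] {n : ℕ} {P : Type*} [AddCommMonoid P]
    {deg : Fin n → P} {D : P} {f : MvPolynomial (Fin n) k}
    (hf : ∀ a ∈ f.support, mdeg deg a = D) : f ∈ degSub deg D := by
  rw [f.as_sum]
  refine Submodule.sum_mem _ fun a ha => ?_
  have h : monomial a (coeff a f) = coeff a f • monomial a (1 : k) := by
    simp [smul_monomial]
  rw [h]
  exact Submodule.smul_mem _ _ (Submodule.subset_span ⟨a, hf a ha, rfl⟩)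

theorem X_mul_mem_degSub {k : Type*} [Field k] {n : ℕ} {P : Type*} [AddCommMonoid P]
    {deg : Fin n → P} {D : P} (i : Fin n) {f : MvPolynomial (Fin n) k}
    (hf : f ∈ degSub deg D) : X i * f ∈ degSub deg (D + deg i) := by
  have h : degSub deg D ≤
      (degSub deg (D + deg i)).comap (LinearMap.mulLeft k (X i : MvPolynomial (Fin n) k)) := by
    refine Submodule.span_le.2 ?_
    rintro _ ⟨a, rfl, rfl⟩
    refine Submodule.subset_span ⟨a + Finsupp.single i 1, ?_, ?_⟩
    · simp [mdeg_add, mdeg_single]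
    · simp [X, monomial_mul, add_comm]
  exact h hf

/-- Multiplication by a variable that is a nonzerodivisor modulo `Q` embeds `(J/Q)_D` into
the piece of `J/Q` whose degree is shifted by the degree of that variable. -/
theorem finrank_idealPiece_add_le {k : Type*} [Field k] {n : ℕ} {P : Type*} [AddCommMonoid P]
    (deg : Fin n → P) (lam : P →+ ℕ) (hlam : ∀ i, lam (deg i) = 1)
    {Q J : Ideal (MvPolynomial (Fin n) k)} (hQJ : Q ≤ J) (i : Fin n)
    (hi : ∀ f : MvPolynomial (Fin n) k, X i * f ∈ Q → f ∈ Q) (D : P) :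
    Module.finrank k (idealPiece J deg D) + Module.finrank k (idealPiece Q deg (D + deg i)) ≤
      Module.finrank k (idealPiece J deg (D + deg i)) + Module.finrank k (idealPiece Q deg D) := by
  have fin := finiteDimensional_idealPiece (k := k) deg lam hlam
  have := fin J D
  have := fin Q D
  have := fin J (D + deg i)
  have := fin Q (D + deg i)
  set μ := LinearMap.mulLeft k (X i : MvPolynomial (Fin n) k)
  have hμ : Function.Injective μ := fun f g h => mul_left_cancel₀ (X_ne_zero i) h
  have hJ : Module.finrank k ((idealPiece J deg D).map μ) =
      Module.finrank k (idealPiece J deg D) :=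
    (Submodule.equivMapOfInjective μ hμ _).finrank_eq.symm
  have hQ : Module.finrank k ((idealPiece Q deg D).map μ) =
      Module.finrank k (idealPiece Q deg D) :=
    (Submodule.equivMapOfInjective μ hμ _).finrank_eq.symm
  rw [← hJ, ← hQ, ← Submodule.finrank_sup_add_finrank_inf_eq]
  refine add_le_add (Submodule.finrank_mono (sup_le ?_ (idealPiece_mono deg hQJ _)))
    (Submodule.finrank_mono ?_)
  · rintro _ ⟨f, hf, rfl⟩
    exact ⟨J.mul_mem_left _ hf.1, X_mul_mem_degSub i hf.2⟩
  · rintro _ ⟨⟨f, hf, rfl⟩, hg⟩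
    exact ⟨f, ⟨hi f hg.1, hf.2⟩, rfl⟩

theorem le_of_idealPiece_le {k : Type*} [Field k] {n : ℕ} {P : Type*} [AddCommMonoid P]
    {deg : Fin n → P} {Q J : Ideal (MvPolynomial (Fin n) k)} (hJ : IsPHomog deg J)
    (h : ∀ D, idealPiece J deg D ≤ idealPiece Q deg D) : J ≤ Q := by
  obtain ⟨S, rfl, hS⟩ := hJ
  refine Ideal.span_le.2 fun f hf => ?_
  obtain ⟨D, hD⟩ := hS f hf
  exact (h D ⟨Ideal.subset_span hf, mem_degSub hD⟩).1

/-- A function on a commutative monoid that does not decrease under adding any `d i` does not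
decrease under adding a natural combination of the `d i`. -/
theorem le_apply_add_sum_nsmul {P ι : Type*} [AddCommMonoid P] {h : P → ℕ}
    (d : ι → P) (hd : ∀ i D, h D ≤ h (D + d i)) (t : Finset ι) (a : ι → ℕ) (D : P) :
    h D ≤ h (D + ∑ i ∈ t, a i • d i) := by
  classical
  have step : ∀ i (c : ℕ) (D : P), h D ≤ h (D + c • d i) := by
    intro i c
    induction c with
    | zero => simp
    | succ c ih =>
      intro D
      rw [succ_nsmul, ← add_assoc]
      exact (ih D).trans (hd i _)
  induction t using Finset.induction_on generalizing D with
  | empty => simp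
  | insert i t hi ih =>
    rw [Finset.sum_insert hi, ← add_assoc]
    exact (step i (a i) D).trans (ih _)

/-- Lemma on Hilbert functions: with variables `e_1,…,e_m` (given by distinct
indices `v i`), ideals `Q^i ⊆ J^i` and a candidate Hilbert function `s`, conditions (1)–(4)
force `Q^i = J^i` for all `i`. -/
theorem stmt5 {k : Type*} [Field k] {n : ℕ} {P : Type*} [AddCommMonoid P]
    (deg : Fin n → P) (lam : P →+ ℕ) (hlam : ∀ i, lam (deg i) = 1)
    (m : ℕ) (v : Fin m → Fin n) (hv : Function.Injective v)
    (Q J : Fin m → Ideal (MvPolynomial (Fin n) k))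
    (hQhom : ∀ i, IsPHomog deg (Q i)) (hJhom : ∀ i, IsPHomog deg (J i))
    (hQJ : ∀ i, Q i ≤ J i)
    (s : P → ℕ)
    (h1 : ∀ i (D : P), Module.finrank k (idealPiece (J i) deg D) = s D)
    (h2 : ∀ i (f : MvPolynomial (Fin n) k), X (v i) * f ∈ Q i → f ∈ Q i)
    (h3 : ∀ i j (D : P),
      Module.finrank k (idealPiece (Q i) deg D) = Module.finrank k (idealPiece (Q j) deg D))
    (h4 : ∀ D : P, ∃ (j : Fin m) (a : Fin m → ℕ),
      Module.finrank k (idealPiece (Q j) deg (D + ∑ i, a i • deg (v i)))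
        = s (D + ∑ i, a i • deg (v i))) :
    ∀ i, Q i = J i := by
  intro i
  have fin := finiteDimensional_idealPiece (k := k) deg lam hlam
  have hle : ∀ j D, Module.finrank k (idealPiece (Q j) deg D) ≤ s D := by
    intro j D
    have := fin (J j) D
    rw [← h1 j D]
    exact Submodule.finrank_mono (idealPiece_mono deg (hQJ j) D)
  have hmono : ∀ j D, s D - Module.finrank k (idealPiece (Q i) deg D) ≤
      s (D + deg (v j)) - Module.finrank k (idealPiece (Q i) deg (D + deg (v j))) := by
    intro j D
    have h := finrank_idealPiece_add_le deg lam hlam (hQJ j) (v j) (h2 j) D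
    rw [h1, h1, h3 j i, h3 j i] at h
    have := hle i D
    have := hle i (D + deg (v j))
    omega
  refine le_antisymm (hQJ i) (le_of_idealPiece_le (hJhom i) fun D => ?_)
  obtain ⟨j, a, hja⟩ := h4 D
  have h := le_apply_add_sum_nsmul
    (h := fun D => s D - Module.finrank k (idealPiece (Q i) deg D))
    (fun j => deg (v j)) hmono Finset.univ a D
  have := fin (J i) D
  refine (Submodule.eq_of_le_of_finrank_le (idealPiece_mono deg (hQJ i) D) ?_).ge
  rw [h3 j i] at hja
  simp only [hja] at h
  rw [h1]
  omega
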